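/- Let k ≥ 1, let N be a positive integer, and let r_1, …, r_{3k} be positive integers satisfying N < 4·r_i and 2·r_i < N for each i, and r_1 + ⋯ + r_{3k} = kN. Define the binary strings s = (∏_{i=1}^{3k} 0^3 1^{r_i}) 0^3 and t = 0^{3(3k+1) − k} (0 1^N)^k, where ∏ denotes concatenation, a^m denotes m consecutive copies of the symbol a, and (w)^m denotes m consecutive copies of the string w. Then the index set {1, 2, …, 3k} can be partitioned into k pairwise disjoint three-element sets A_1, …, A_k with Σ_{i ∈ A_j} r_i = N for each j, if and only if d(s, t) ≤ 6k. -/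

import Mathlib

/-- Prefix reversal (flip) of the first `i` symbols of `s`. -/
def pflip (i : ℕ) (s : List ℕ) : List ℕ := (s.take i).reverse ++ s.drop i

/-- One flip step: `t` is obtained from `s` by some flip `f^(i)` with `1 ≤ i ≤ |s|`. -/
def FlipStep (s t : List ℕ) : Prop := ∃ i, 1 ≤ i ∧ i ≤ s.length ∧ t = pflip i s

/-- `ReachIn m s t`: `t` can be obtained from `s` by exactly `m` flips. -/
def ReachIn : ℕ → List ℕ → List ℕ → Prop
  | 0 => fun s t => s = t
  | (m+1) => fun s t => ∃ u, FlipStep s u ∧ ReachIn m u t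

/-- Flip distance: minimum number of flips transforming `s` into `t`. -/
noncomputable def flipDist (s t : List ℕ) : ℕ := sInf {m | ReachIn m s t}

/-- Two strings are compatible if every symbol occurs equally often in both. -/
def Compatible (s t : List ℕ) : Prop := ∀ a, s.count a = t.count a

/-- A string is fully `k`-ary if the set of symbols occurring in it is exactly `{0,…,k-1}`. -/
def FullyKary (k : ℕ) (s : List ℕ) : Prop := ∀ a, a ∈ s ↔ a < k

/-- A string is normalized if no two adjacent symbols are equal. -/
def Normalized (s : List ℕ) : Prop := s.Chain' (· ≠ ·)

/-- A string is grouped if the occurrences of each symbol are consecutive. -/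
def Grouped (s : List ℕ) : Prop :=
  ∀ i j l : Fin s.length, i < j → j < l → s.get i = s.get l → s.get j = s.get i

/-- Flip grouping distance: minimum number of flips transforming `s` into some grouped string. -/
noncomputable def groupDist (s : List ℕ) : ℕ := sInf {m | ∃ t, Grouped t ∧ ReachIn m s t}

/-- Flip sorting distance: flip distance from `s` to its non-descending rearrangement `I(s)`. -/
noncomputable def sortDist (s : List ℕ) : ℕ := flipDist s (s.insertionSort (· ≤ ·))

/-- `rep w m` is the concatenation of `m` copies of the string `w`. -/
def rep (w : List ℕ) (m : ℕ) : List ℕ := (List.replicate m w).flatten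

/-! ### Basic facts about flips -/

lemma flipStep_append (p q : List ℕ) (h : p ++ q ≠ []) : FlipStep (p ++ q) (p.reverse ++ q) := by
  by_cases hp : p = []
  · subst hp
    cases q with
    | nil => simp at h
    | cons x q => exact ⟨1, le_refl _, by simp, by simp [pflip]⟩
  · refine ⟨p.length, List.length_pos_iff.mpr hp, by simp, by simp [pflip]⟩

lemma flipStep_exists {s t : List ℕ} (h : FlipStep s t) :
    ∃ p q, s = p ++ q ∧ t = p.reverse ++ q := by
  obtain ⟨i, _, _, rfl⟩ := h
  exact ⟨s.take i, s.drop i, (List.take_append_drop i s).symm, rfl⟩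

lemma reach_trans {m n : ℕ} {s t u : List ℕ} (h1 : ReachIn m s t) (h2 : ReachIn n t u) :
    ReachIn (m + n) s u := by
  induction m generalizing s with
  | zero => simp only [ReachIn] at h1; subst h1; simpa using h2
  | succ m ih =>
    obtain ⟨v, hv, hr⟩ := h1
    have := ih hr
    rw [show m + 1 + n = (m + n) + 1 by ring]
    exact ⟨v, hv, this⟩

lemma reach_two {s t u : List ℕ} (h1 : FlipStep s t) (h2 : FlipStep t u) : ReachIn 2 s u :=
  ⟨t, h1, u, h2, rfl⟩

lemma reach_perm {m : ℕ} {s t : List ℕ} (h : ReachIn m s t) : s.Perm t := by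
  induction m generalizing s with
  | zero => simp only [ReachIn] at h; subst h; exact List.Perm.refl _
  | succ m ih =>
    obtain ⟨v, hv, hr⟩ := h
    obtain ⟨p, q, rfl, rfl⟩ := flipStep_exists hv
    exact (((List.reverse_perm p).append_right q).symm).trans (ih hr)

lemma perm_reach {s t : List ℕ} (h : s.Perm t) : ∀ p : List ℕ, ∃ m, ReachIn m (p ++ s) (p ++ t) := by
  induction h with
  | nil => intro p; exact ⟨0, rfl⟩
  | cons x _ ih => intro p; simpa using ih (p ++ [x])
  | swap x y l =>
    intro p
    refine ⟨3, x :: y :: (p.reverse ++ l), ?_, y :: x :: (p.reverse ++ l), ?_, _, ?_, rfl⟩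
    · simpa using flipStep_append (p ++ [y, x]) l (by simp)
    · simpa using flipStep_append [x, y] (p.reverse ++ l) (by simp)
    · simpa using flipStep_append ([y, x] ++ p.reverse) l (by simp)
  | trans _ _ ih1 ih2 =>
    intro p
    obtain ⟨m, hm⟩ := ih1 p
    obtain ⟨n, hn⟩ := ih2 p
    exact ⟨m + n, reach_trans hm hn⟩

/-! ### Chunk lengths -/

/-- Lengths of the (possibly empty) pieces of `w` between consecutive separators. -/
def ch (P : ℕ → Bool) : List ℕ → List ℕ
  | [] => [0]
  | x :: w => if P x then 0 :: ch P w else (ch P w).modifyHead (· + 1)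

lemma ch_cons_form (P : ℕ → Bool) (w : List ℕ) : ∃ x B, ch P w = x :: B := by
  induction w with
  | nil => exact ⟨0, [], rfl⟩
  | cons h w ih =>
    obtain ⟨x, B, hx⟩ := ih
    by_cases hP : P h
    · exact ⟨0, ch P w, by simp [ch, hP]⟩
    · exact ⟨x + 1, B, by simp [ch, hP, hx]⟩

lemma ch_append (P : ℕ → Bool) (u v : List ℕ) : ∃ A x y B,
    ch P u = A ++ [x] ∧ ch P v = y :: B ∧ ch P (u ++ v) = A ++ (x + y) :: B := by
  induction u with
  | nil =>
    obtain ⟨y, B, h⟩ := ch_cons_form P v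
    exact ⟨[], 0, y, B, rfl, h, by simp [h]⟩
  | cons h u ih =>
    obtain ⟨A, x, y, B, h1, h2, h3⟩ := ih
    by_cases hP : P h
    · exact ⟨0 :: A, x, y, B, by simp [ch, hP, h1], h2, by simp [ch, hP, h3]⟩
    · cases A with
      | nil => exact ⟨[], x + 1, y, B, by simp [ch, hP, h1], h2, by simp [ch, hP, h3]; omega⟩
      | cons a A => exact ⟨(a + 1) :: A, x, y, B, by simp [ch, hP, h1], h2, by simp [ch, hP, h3]⟩

lemma ch_sep (P : ℕ → Bool) (u v : List ℕ) (x : ℕ) (hx : P x = true) :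
    ch P (u ++ x :: v) = ch P u ++ ch P v := by
  obtain ⟨A, a, y, B, h1, h2, h3⟩ := ch_append P u (x :: v)
  simp only [ch, hx, if_true] at h2
  injection h2 with h4 h5
  subst h4 h5
  simp [h3, h1]

lemma ch_reverse (P : ℕ → Bool) (u : List ℕ) : ch P u.reverse = (ch P u).reverse := by
  induction u with
  | nil => rfl
  | cons h u ih =>
    by_cases hP : P h
    · rw [List.reverse_cons, ch_sep P u.reverse [] h hP, ih]
      simp [ch, hP]
    · obtain ⟨x, B, hx⟩ := ch_cons_form P u
      obtain ⟨A, a, y, C, h1, h2, h3⟩ := ch_append P u.reverse [h]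
      rw [ih, hx, List.reverse_cons] at h1
      have h2' : y = 1 ∧ C = [] := by
        simp [ch, hP] at h2; tauto
      obtain ⟨rfl, rfl⟩ := h2'
      obtain ⟨h4, h5⟩ := List.append_inj' h1 rfl
      simp only [List.cons.injEq, and_true] at h5
      subst h4 h5
      rw [List.reverse_cons, h3]
      simp [ch, hP, hx]

lemma ch_head_pos (P : ℕ → Bool) (u : List ℕ) (x : ℕ) (B : List ℕ) (h : ch P u = x :: B)
    (hx : 0 < x) : ∃ a u', u = a :: u' ∧ P a = false := by
  cases u with
  | nil => simp [ch] at h; omega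
  | cons a u =>
    refine ⟨a, u, rfl, ?_⟩
    by_contra hP
    have hP' : P a = true := by simpa using hP
    simp [ch, hP'] at h
    omega

lemma ch_singleton (P : ℕ → Bool) (u : List ℕ) (x : ℕ) (h : ch P u = [x]) :
    ∀ a ∈ u, P a = false := by
  induction u generalizing x with
  | nil => simp
  | cons a u ih =>
    obtain ⟨y, B, hy⟩ := ch_cons_form P u
    by_cases hP : P a
    · simp [ch, hP, hy] at h
    · simp [ch, hP, hy] at h
      obtain ⟨_, rfl⟩ := h
      intro b hb
      rcases List.mem_cons.mp hb with rfl | hb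
      · simpa using hP
      · exact ih y hy b hb

/-- Zero is counted, everything else separates. -/
def sepOne : ℕ → Bool := fun x => x != 0
/-- Zero separates, everything else is counted. -/
def sepZero : ℕ → Bool := fun x => x == 0

/-- Weight of a zero chunk that is not at the front. -/
def al (z : ℕ) : ℕ := min 2 (z - 1)
/-- Weight of the zero chunk at the front. -/
def be (z : ℕ) : ℕ := min 1 (z - 1)

/-- Potential of a list of chunks. -/
def potL : List ℕ → ℕ
  | [] => 0
  | a :: L => be a + (L.map al).sum

/-- Potential of a string. -/
def pot (w : List ℕ) : ℕ := potL (ch sepOne w)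

/-- The runs of ones of `w` are obtained by grouping the `r i`. -/
def GrpInv {n : ℕ} (r : Fin n → ℕ) (w : List ℕ) : Prop :=
  ∃ S : Multiset (Multiset (Fin n)), S.sum = Finset.univ.val ∧
    S.map (fun g => (g.map r).sum) = (ch sepZero w : Multiset ℕ)

lemma inv_congr {n : ℕ} {r : Fin n → ℕ} {w w' : List ℕ}
    (h : (ch sepZero w : Multiset ℕ) = (ch sepZero w' : Multiset ℕ)) (hw : GrpInv r w) : GrpInv r w' := by
  obtain ⟨S, h1, h2⟩ := hw
  exact ⟨S, h1, h2.trans h⟩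

lemma inv_merge {n : ℕ} {r : Fin n → ℕ} {w w' : List ℕ} {x y : ℕ} {R : Multiset ℕ}
    (h : (ch sepZero w : Multiset ℕ) = x ::ₘ y ::ₘ R)
    (h' : (ch sepZero w' : Multiset ℕ) = 0 ::ₘ (x + y) ::ₘ R) (hw : GrpInv r w) : GrpInv r w' := by
  obtain ⟨S, h1, h2⟩ := hw
  rw [h] at h2
  obtain ⟨g1, hg1, hx, h3⟩ := (Multiset.map_eq_cons _ _ _ _).mpr h2
  obtain ⟨g2, hg2, hy, h4⟩ := (Multiset.map_eq_cons _ _ _ _).mpr h3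
  refine ⟨0 ::ₘ (g1 + g2) ::ₘ ((S.erase g1).erase g2), ?_, ?_⟩
  · rw [← h1, ← Multiset.cons_erase hg1, ← Multiset.cons_erase hg2]
    simp [add_assoc]
  · rw [h']
    simp [hx, hy, h4]

lemma step_main {n : ℕ} (r : Fin n → ℕ) {w w' : List ℕ} (h : FlipStep w w') :
    pot w ≤ pot w' + 1 ∧ (pot w = pot w' + 1 → GrpInv r w → GrpInv r w') := by
  obtain ⟨p, q, rfl, rfl⟩ := flipStep_exists h
  obtain ⟨A, c, d, B, h1, h2, h3⟩ := ch_append sepOne p q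
  cases A with
  | nil =>
    have hp := ch_singleton sepOne p c (by simpa using h1)
    have : p.reverse = p := by
      have h0 : p = List.replicate p.length 0 :=
        List.eq_replicate_iff.mpr ⟨rfl, fun b hb => by simpa [sepOne] using hp b hb⟩
      rw [h0, List.reverse_replicate]
    rw [this]
    exact ⟨by omega, fun _ h => h⟩
  | cons a A =>
    obtain ⟨A', a', d', B', h1', h2', h3'⟩ := ch_append sepOne p.reverse q
    have hrev : ch sepOne p.reverse = c :: A.reverse ++ [a] := by
      rw [ch_reverse, h1]; simp
    rw [hrev] at h1'
    obtain ⟨h4, h5⟩ := List.append_inj' h1' rfl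
    simp only [List.cons.injEq, and_true] at h5
    rw [h2] at h2'
    injection h2' with h6 h7
    subst h4 h5 h6 h7
    have e1 : pot (p ++ q) = be a + ((A.map al).sum + (al (c + d) + (B.map al).sum)) := by
      simp [pot, h3, potL]
    have e2 : pot (p.reverse ++ q) = be c + ((A.map al).sum + (al (a + d) + (B.map al).sum)) := by
      simp [pot, h3', potL]
    have key : be a + al (c + d) ≤ be c + al (a + d) + 1 := by
      simp only [be, al]; omega
    refine ⟨by omega, fun heq => ?_⟩
    have heq' : be a + al (c + d) = be c + al (a + d) + 1 := by omega
    have hc : 0 < c ∨ (0 < a ∧ 0 < d) := by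
      by_contra hcon
      simp only [be, al] at heq'
      omega
    have hz : sepZero 0 = true := rfl
    rcases hc with hc | ⟨ha, hd⟩
    · obtain ⟨z, p', hp', hz'⟩ := ch_head_pos sepOne p.reverse c _ (by rw [hrev]; rfl) hc
      have hz0 : z = 0 := by simpa [sepOne] using hz'
      subst hz0
      have hp : p = p'.reverse ++ [0] := by
        rw [← List.reverse_reverse p, hp']; simp
      obtain ⟨A2, x, y, B2, k1, k2, k3⟩ := ch_append sepZero p' q
      refine inv_merge (x := x) (y := y) (R := (A2 : Multiset ℕ) + (B2 : Multiset ℕ)) ?_ ?_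
      · rw [hp, List.append_assoc, List.singleton_append, ch_sep _ _ _ _ hz, ch_reverse, k1, k2,
          ← Multiset.coe_add, Multiset.coe_reverse, ← Multiset.coe_add, Multiset.coe_singleton,
          ← Multiset.cons_coe, ← Multiset.singleton_add x, ← Multiset.singleton_add y,
          ← Multiset.singleton_add y]
        abel
      · rw [hp', List.cons_append]
        simp only [ch, hz, if_true]
        rw [k3, ← Multiset.cons_coe, ← Multiset.coe_add, ← Multiset.cons_coe, Multiset.add_cons]
    · obtain ⟨z, p', hp', hz'⟩ := ch_head_pos sepOne p a _ (by rw [h1]; rfl) ha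
      have hz0 : z = 0 := by simpa [sepOne] using hz'
      subst hz0
      obtain ⟨z, q', hq', hz'⟩ := ch_head_pos sepOne q d _ h2 hd
      have hz0 : z = 0 := by simpa [sepOne] using hz'
      subst hz0
      refine inv_congr ?_
      rw [hp', hq', List.cons_append, List.reverse_cons, List.append_assoc, List.singleton_append,
        ch_sep _ _ _ _ hz, ch_reverse]
      simp only [ch, hz, if_true]
      rw [ch_sep _ _ _ _ hz, ← Multiset.cons_coe, ← Multiset.coe_add, ← Multiset.coe_add,
        ← Multiset.cons_coe, Multiset.coe_reverse, Multiset.add_cons]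

lemma reach_main {n : ℕ} (r : Fin n → ℕ) {m : ℕ} {w t : List ℕ} (h : ReachIn m w t) :
    pot w ≤ pot t + m ∧ (pot w = pot t + m → GrpInv r w → GrpInv r t) := by
  induction m generalizing w with
  | zero => simp only [ReachIn] at h; subst h; exact ⟨le_refl _, fun _ h => h⟩
  | succ m ih =>
    obtain ⟨u, hu, hr⟩ := h
    obtain ⟨a1, a2⟩ := step_main r hu
    obtain ⟨b1, b2⟩ := ih hr
    exact ⟨by omega, fun he hi => b2 (by omega) (a2 (by omega) hi)⟩

/-! ### Evaluating the invariants on `s` and `t` -/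

/-- The source string, from the list of run lengths. -/
def src (l : List ℕ) : List ℕ :=
  (l.map (fun a => [0,0,0] ++ List.replicate a 1)).flatten ++ [0,0,0]

lemma src_cons (a : ℕ) (l : List ℕ) :
    src (a :: l) = 0 :: 0 :: 0 :: (List.replicate a 1 ++ src l) := by
  simp [src]

lemma ch_ones_append (n : ℕ) (w : List ℕ) :
    ch sepOne (List.replicate n 1 ++ w) = List.replicate n 0 ++ ch sepOne w := by
  induction n with
  | zero => simp
  | succ n ih => simp [List.replicate_succ, ch, sepOne] ; simpa [sepOne] using ih

lemma ch_src (l : List ℕ) (hl : ∀ a ∈ l, 0 < a) :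
    ∃ L, ch sepOne (src l) = 3 :: L ∧ (L.map al).sum = 2 * l.length := by
  induction l with
  | nil => exact ⟨[], rfl, rfl⟩
  | cons a l ih =>
    obtain ⟨L, h1, h2⟩ := ih (fun b hb => hl b (List.mem_cons_of_mem _ hb))
    have ha := hl a List.mem_cons_self
    obtain ⟨b, rfl⟩ : ∃ b, a = b + 1 := ⟨a - 1, by omega⟩
    refine ⟨List.replicate b 0 ++ 3 :: L, ?_, ?_⟩
    · have := ch_ones_append (b + 1) (src l)
      rw [src_cons]
      simp only [ch]
      rw [this, h1]
      simp [sepOne, List.replicate_succ]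
    · simp [h2, al]; omega

lemma chz_src (l : List ℕ) : ∃ m, (ch sepZero (src l) : Multiset ℕ) = (l : Multiset ℕ) + Multiset.replicate m 0 ∧
    ∃ T, src l = 0 :: T := by
  induction l with
  | nil => exact ⟨4, rfl, _, rfl⟩
  | cons a l ih =>
    obtain ⟨m, h1, T, h2⟩ := ih
    have hrep : ch sepZero (List.replicate a 1) = [a] := by
      clear h1 h2
      induction a with
      | zero => rfl
      | succ a ih => simp [List.replicate_succ, ch, ih, sepZero]
    have hz : sepZero 0 = true := rfl
    refine ⟨m + 2, ?_, _, src_cons a l⟩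
    have h3 : (ch sepZero T : Multiset ℕ) + {0} = (l : Multiset ℕ) + Multiset.replicate m 0 := by
      rw [← h1, h2]
      simp only [ch, hz, if_true]
      rw [← Multiset.cons_coe, add_comm, Multiset.singleton_add]
    rw [src_cons, h2]
    simp only [ch, hz, if_true]
    rw [ch_sep _ _ _ _ hz, hrep]
    have : ((0 :: 0 :: 0 :: ([a] ++ ch sepZero T) : List ℕ) : Multiset ℕ) =
        {a} + {0} + {0} + ((ch sepZero T : Multiset ℕ) + {0}) := by
      simp only [List.singleton_append, ← Multiset.cons_coe, ← Multiset.singleton_add]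
      abel
    rw [this, h3, ← Multiset.cons_coe, ← Multiset.singleton_add a, Multiset.replicate_add,
      show Multiset.replicate 2 0 = ({0} + {0} : Multiset ℕ) from rfl]
    abel

lemma rep_succ (w : List ℕ) (k : ℕ) : rep w (k + 1) = w ++ rep w k := by
  simp [rep, List.replicate_succ]

lemma ch_rep (N k : ℕ) (hN : 0 < N) :
    ∀ x ∈ ch sepOne (rep (0 :: List.replicate N 1) k), x ≤ 1 := by
  obtain ⟨b, rfl⟩ : ∃ b, N = b + 1 := ⟨N - 1, by omega⟩
  induction k with
  | zero => simp [rep, ch]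
  | succ k ih =>
    rw [rep_succ, List.cons_append]
    simp only [ch]
    rw [ch_ones_append]
    simp only [sepOne, List.replicate_succ, List.cons_append, List.modifyHead_cons]
    intro x hx
    simp at hx
    rcases hx with rfl | hx | hx
    · simp
    · omega
    · exact ih x hx

lemma ch_zeros_append (n : ℕ) (w : List ℕ) (x : ℕ) (B : List ℕ) (h : ch sepOne w = x :: B) :
    ch sepOne (List.replicate n 0 ++ w) = (x + n) :: B := by
  induction n with
  | zero => simpa using h
  | succ n ih =>
    rw [List.replicate_succ, List.cons_append]
    simp only [ch, ih]
    simp [sepOne]; omega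

lemma pot_tgt (N k m : ℕ) (hN : 0 < N) (hm : 2 ≤ m) :
    pot (List.replicate m 0 ++ rep (0 :: List.replicate N 1) k) = 1 := by
  obtain ⟨x, B, h⟩ := ch_cons_form sepOne (rep (0 :: List.replicate N 1) k)
  have hle := ch_rep N k hN
  rw [h] at hle
  rw [pot, ch_zeros_append m _ x B h, potL]
  have : (B.map al).sum = 0 := by
    rw [List.sum_eq_zero_iff]
    intro y hy
    obtain ⟨z, hz, rfl⟩ := List.mem_map.mp hy
    have := hle z (List.mem_cons_of_mem _ hz)
    simp only [al]; omega
  rw [this]; simp only [be]; omega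

lemma chz_zeros (n : ℕ) (w : List ℕ) :
    ch sepZero (List.replicate n 0 ++ w) = List.replicate n 0 ++ ch sepZero w := by
  induction n with
  | zero => simp
  | succ n ih => simp [List.replicate_succ, ch, ih, sepZero]

lemma chz_ones (n : ℕ) (w : List ℕ) (x : ℕ) (B : List ℕ) (h : ch sepZero w = x :: B) :
    ch sepZero (List.replicate n 1 ++ w) = (x + n) :: B := by
  induction n with
  | zero => simpa using h
  | succ n ih =>
    rw [List.replicate_succ, List.cons_append]
    simp only [ch, ih]
    simp [sepZero]; omega

lemma chz_rep (N k : ℕ) :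
    ch sepZero (rep (0 :: List.replicate N 1) k) = 0 :: List.replicate k N := by
  induction k with
  | zero => rfl
  | succ k ih =>
    rw [rep_succ, List.cons_append]
    simp only [ch]
    rw [chz_ones N _ _ _ ih]
    simp [sepZero, List.replicate_succ]

/-! ### Extracting the partition -/

lemma ms_map_eq_add {α : Type} [DecidableEq α] (f : α → ℕ) (A B : Multiset ℕ) (S : Multiset α)
    (h : S.map f = A + B) : ∃ S0 S1, S = S0 + S1 ∧ S0.map f = A ∧ S1.map f = B := by
  induction A using Multiset.induction_on generalizing S with
  | empty => exact ⟨0, S, by simp, by simp, by simpa using h⟩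
  | cons a A ih =>
    rw [Multiset.cons_add] at h
    obtain ⟨g, hg, hx, h3⟩ := (Multiset.map_eq_cons _ _ _ _).mpr h
    obtain ⟨S0, S1, e, e0, e1⟩ := ih _ h3
    refine ⟨g ::ₘ S0, S1, ?_, ?_, e1⟩
    · rw [Multiset.cons_add, ← e, Multiset.cons_erase hg]
    · rw [Multiset.map_cons, hx, e0]

lemma list_ofFn_of_length {α : Type} (L : List α) (k : ℕ) (h : L.length = k) :
    ∃ f : Fin k → α, L = List.ofFn f := by
  subst h
  exact ⟨L.get, by simp⟩

lemma card_three {n N : ℕ} (hN : 0 < N) (r : Fin n → ℕ) (hlb : ∀ i, N < 4 * r i) (hub : ∀ i, 2 * r i < N)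
    (Q : Finset (Fin n)) (hs : ∑ i ∈ Q, r i = N) : Q.card = 3 := by
  have a1 : ∑ _i ∈ Q, (N + 1) ≤ ∑ i ∈ Q, 4 * r i := Finset.sum_le_sum (fun i _ => hlb i)
  have a2 : ∑ i ∈ Q, (2 * r i + 1) ≤ ∑ _i ∈ Q, N := Finset.sum_le_sum (fun i _ => hub i)
  rw [← Finset.mul_sum, hs, Finset.sum_const, smul_eq_mul] at a1
  rw [Finset.sum_add_distrib, ← Finset.mul_sum, hs, Finset.sum_const, Finset.sum_const,
    smul_eq_mul, smul_eq_mul] at a2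
  generalize Q.card = c at *
  have : c < 4 := by
    by_contra hc
    push Not at hc
    nlinarith
  interval_cases c <;> omega

lemma extract (k N : ℕ) (hN : 0 < N)
    (r : Fin (3*k) → ℕ) (hrpos : ∀ i, 0 < r i)
    (hlb : ∀ i, N < 4 * r i) (hub : ∀ i, 2 * r i < N) (m : ℕ)
    (h : GrpInv r (List.replicate m 0 ++ rep (0 :: List.replicate N 1) k)) :
    ∃ P : Fin k → Finset (Fin (3*k)),
        (∀ j, (P j).card = 3) ∧
        (∀ j, ∑ i ∈ P j, r i = N) ∧
        (∀ j₁ j₂, j₁ ≠ j₂ → Disjoint (P j₁) (P j₂)) ∧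
        (∀ i, ∃ j, i ∈ P j) := by
  obtain ⟨S, h1, h2⟩ := h
  rw [chz_zeros, chz_rep] at h2
  have h2' : S.map (fun g => (g.map r).sum) =
      Multiset.replicate (m + 1) 0 + Multiset.replicate k N := by
    rw [h2, Multiset.replicate_add]
    simp only [← Multiset.coe_add, ← Multiset.cons_coe, Multiset.coe_replicate,
      Multiset.replicate_one, Multiset.add_cons, Multiset.singleton_add, Multiset.cons_add]
    rw [Multiset.add_assoc, Multiset.singleton_add, Multiset.add_cons]
  obtain ⟨S0, S1, rfl, hS0, hS1⟩ := ms_map_eq_add _ _ _ _ h2'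
  have hz : S0.sum = 0 := by
    apply Multiset.sum_eq_zero
    intro g hg
    have : (g.map r).sum ∈ S0.map (fun g => (g.map r).sum) := Multiset.mem_map_of_mem _ hg
    rw [hS0] at this
    have h0 := Multiset.eq_of_mem_replicate this
    rw [Multiset.sum_eq_zero_iff] at h0
    rw [Multiset.eq_zero_iff_forall_notMem]
    intro i hi
    have := h0 (r i) (Multiset.mem_map_of_mem _ hi)
    have := hrpos i
    omega
  rw [Multiset.sum_add, hz, zero_add] at h1
  have hcard : S1.card = k := by
    have := congrArg Multiset.card hS1
    simpa using this
  obtain ⟨L, rfl⟩ : ∃ L : List (Multiset (Fin (3*k))), S1 = L := ⟨S1.toList, by simp⟩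
  have hlen : L.length = k := by simpa using hcard
  obtain ⟨f, rfl⟩ : ∃ f : Fin k → Multiset (Fin (3*k)), L = List.ofFn f := by
    exact list_ofFn_of_length L k hlen
  have hsumf : ∑ j, f j = Finset.univ.val := by
    rw [← h1, Multiset.sum_coe, List.sum_ofFn]
  have hf : ∀ j, ((f j).map r).sum = N := by
    intro j
    have : ((f j).map r).sum ∈ (↑(List.ofFn f) : Multiset (Multiset (Fin (3*k)))).map (fun g => (g.map r).sum) :=
      Multiset.mem_map_of_mem _ (by simp)
    rw [hS1] at this
    exact Multiset.eq_of_mem_replicate this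
  have hcount : ∀ i, ∑ j, (f j).count i = 1 := by
    intro i
    rw [← Multiset.count_sum', hsumf]
    exact Multiset.count_eq_one_of_mem Finset.univ.nodup (Finset.mem_univ i)
  have hnd : ∀ j, (f j).Nodup := by
    intro j
    rw [Multiset.nodup_iff_count_le_one]
    intro i
    rw [← hcount i]
    exact Finset.single_le_sum (f := fun j => (f j).count i) (fun _ _ => Nat.zero_le _)
      (Finset.mem_univ j)
  have hsumP : ∀ j, ∑ i ∈ (⟨f j, hnd j⟩ : Finset (Fin (3*k))), r i = N := hf
  refine ⟨fun j => ⟨f j, hnd j⟩, ?_, hsumP, ?_, ?_⟩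
  · exact fun j => card_three hN r hlb hub _ (hsumP j)
  · intro j₁ j₂ hne
    rw [Finset.disjoint_left]
    intro i hi1 hi2
    have hi1 : i ∈ f j₁ := hi1
    have hi2 : i ∈ f j₂ := hi2
    have := Finset.sum_le_sum_of_subset (f := fun j => (f j).count i)
      (Finset.subset_univ ({j₁, j₂} : Finset (Fin k)))
    rw [Finset.sum_pair hne, hcount i] at this
    have b1 := Multiset.count_pos.mpr hi1
    have b2 := Multiset.count_pos.mpr hi2
    omega
  · intro i
    by_contra hcon
    push Not at hcon
    have : ∑ j, (f j).count i = 0 :=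
      Finset.sum_eq_zero (fun j _ => Multiset.count_eq_zero.mpr (hcon j))
    rw [hcount i] at this
    omega

/-! ### The constructive direction -/

/-- Concatenation of blocks `1^a 0^y`. -/
def bl (L : List (ℕ × ℕ)) : List ℕ :=
  L.flatMap (fun p => List.replicate p.1 1 ++ List.replicate p.2 0)

lemma bl_cons (a y : ℕ) (L : List (ℕ × ℕ)) :
    bl ((a, y) :: L) = List.replicate a 1 ++ (List.replicate y 0 ++ bl L) := by
  simp [bl]

lemma bl_append (L K : List (ℕ × ℕ)) : bl (L ++ K) = bl L ++ bl K := by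
  simp [bl]

/-- `w` is of the form `0^x ∏ 1^{a_i} 0^{y_i}` with the `a_i` forming `M`. -/
def St (M : Multiset ℕ) (w : List ℕ) : Prop :=
  ∃ x L, 1 ≤ x ∧ (∀ p ∈ L, 1 ≤ p.2) ∧ ((L.map Prod.fst : List ℕ) : Multiset ℕ) = M ∧
    w = List.replicate x 0 ++ bl L

lemma bl_reverse (L K : List (ℕ × ℕ)) (n : ℕ) (hn : 1 ≤ n) (hL : ∀ p ∈ L, 1 ≤ p.2)
    (hK : ∀ p ∈ K, 1 ≤ p.2) :
    ∃ x K', 1 ≤ x ∧ (∀ p ∈ K', 1 ≤ p.2) ∧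
      ((K'.map Prod.fst : List ℕ) : Multiset ℕ) = ↑(L.map Prod.fst) + ↑(K.map Prod.fst) ∧
      (bl L).reverse ++ (List.replicate n 0 ++ bl K) = List.replicate x 0 ++ bl K' := by
  induction L generalizing K n with
  | nil => exact ⟨n, K, hn, hK, by simp, by simp [bl]⟩
  | cons p L ih =>
    obtain ⟨a, y⟩ := p
    obtain ⟨x, K', h1, h2, h3, h4⟩ := ih ((a, n) :: K) y (hL _ List.mem_cons_self)
      (fun p hp => hL p (List.mem_cons_of_mem _ hp))
      (by
        intro p hp
        rcases List.mem_cons.mp hp with rfl | hp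
        · exact hn
        · exact hK p hp)
    refine ⟨x, K', h1, h2, ?_, ?_⟩
    · rw [h3]
      simp only [List.map_cons, ← Multiset.cons_coe, Multiset.add_cons, Multiset.cons_add]
    · rw [← h4, bl_cons, bl_cons]
      simp

lemma merge_aux (x : ℕ) (L1 L2 L3 : List (ℕ × ℕ)) (a y b z : ℕ) (hx : 1 ≤ x)
    (hL : ∀ p ∈ L1 ++ (a, y) :: (L2 ++ (b, z) :: L3), 1 ≤ p.2) :
    ∃ w', ReachIn 2 (List.replicate x 0 ++ bl (L1 ++ (a, y) :: (L2 ++ (b, z) :: L3))) w' ∧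
      St ((a + b) ::ₘ (↑(L1.map Prod.fst) + ↑(L2.map Prod.fst) + ↑(L3.map Prod.fst))) w' := by
  obtain ⟨x', K', h1, h2, h3, h4⟩ := bl_reverse L2 (L1 ++ (a + b, z) :: L3) (x + y) (by omega)
    (fun p hp => hL p (by simp [hp]))
    (by
      intro p hp
      simp only [List.mem_append, List.mem_cons] at hp
      rcases hp with hp | rfl | hp
      · exact hL p (by simp [hp])
      · exact hL (b, z) (by simp)
      · exact hL p (by simp [hp]))
  refine ⟨List.replicate x' 0 ++ bl K', ?_, x', K', h1, h2, ?_, rfl⟩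
  · have f1 := flipStep_append (List.replicate x 0 ++ bl L1 ++ List.replicate a 1)
      (List.replicate y 0 ++ bl (L2 ++ (b, z) :: L3)) (by
        intro h
        have := congrArg List.length h
        simp at this
        omega)
    have f2 := flipStep_append
      (List.replicate a 1 ++ (bl L1).reverse ++ List.replicate (x + y) 0 ++ bl L2)
      (List.replicate b 1 ++ (List.replicate z 0 ++ bl L3)) (by
        intro h
        have := congrArg List.length h
        simp at this
        omega)
    have e : List.replicate x 0 ++ bl (L1 ++ (a, y) :: (L2 ++ (b, z) :: L3)) =
        List.replicate x 0 ++ bl L1 ++ List.replicate a 1 ++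
          (List.replicate y 0 ++ bl (L2 ++ (b, z) :: L3)) := by
      simp [bl_append, bl_cons]
    rw [e, ← h4]
    refine reach_two f1 ?_
    convert f2 using 1
    · simp [bl_append, bl_cons, List.replicate_add, -List.replicate_append_replicate]
    · simp [bl_append, bl_cons, List.replicate_add a b, -List.replicate_append_replicate]
  · rw [h3]
    simp only [List.map_append, List.map_cons, ← Multiset.coe_add, ← Multiset.cons_coe,
      Multiset.add_cons]
    congr 1
    abel

lemma merge (a b : ℕ) (M : Multiset ℕ) (w : List ℕ) (h : St (a ::ₘ b ::ₘ M) w) :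
    ∃ w', ReachIn 2 w w' ∧ St ((a + b) ::ₘ M) w' := by
  obtain ⟨x, L, hx, hL, hM, rfl⟩ := h
  have ha : a ∈ L.map Prod.fst := by
    rw [← Multiset.mem_coe, hM]; simp
  obtain ⟨⟨a', y⟩, hp, rfl⟩ := List.mem_map.mp ha
  obtain ⟨L1, L2, rfl⟩ := List.append_of_mem hp
  have hM2 : ((L1.map Prod.fst : List ℕ) : Multiset ℕ) + ↑(L2.map Prod.fst) = b ::ₘ M := by
    simp only [List.map_append, List.map_cons, ← Multiset.coe_add, ← Multiset.cons_coe,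
      Multiset.add_cons] at hM
    exact (Multiset.cons_inj_right _).mp hM
  have hb : b ∈ ((L1.map Prod.fst : List ℕ) : Multiset ℕ) + ↑(L2.map Prod.fst) := by
    rw [hM2]; simp
  rw [Multiset.mem_add, Multiset.mem_coe, Multiset.mem_coe] at hb
  rcases hb with hb | hb
  · obtain ⟨⟨b', z⟩, hp', rfl⟩ := List.mem_map.mp hb
    obtain ⟨L3, L4, rfl⟩ := List.append_of_mem hp'
    have e : L3 ++ (b', z) :: L4 ++ (a', y) :: L2 = L3 ++ (b', z) :: (L4 ++ (a', y) :: L2) := by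
      simp
    rw [e] at hL ⊢
    obtain ⟨w', h1, h2⟩ := merge_aux x L3 L4 L2 b' z a' y hx hL
    refine ⟨w', h1, ?_⟩
    simp only [List.map_append, List.map_cons, ← Multiset.coe_add, ← Multiset.cons_coe,
      Multiset.add_cons, Multiset.cons_add] at hM2
    rw [(Multiset.cons_inj_right _).mp hM2] at h2
    rw [add_comm]
    exact h2
  · obtain ⟨⟨b', z⟩, hp', rfl⟩ := List.mem_map.mp hb
    obtain ⟨L3, L4, rfl⟩ := List.append_of_mem hp'
    obtain ⟨w', h1, h2⟩ := merge_aux x L1 L3 L4 a' y b' z hx hL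
    refine ⟨w', h1, ?_⟩
    simp only [List.map_append, List.map_cons, ← Multiset.coe_add, ← Multiset.cons_coe,
      Multiset.add_cons, Multiset.cons_add, ← add_assoc] at hM2
    rw [(Multiset.cons_inj_right _).mp hM2] at h2
    exact h2

lemma phase_one {n k N : ℕ} (r : Fin n → ℕ) (P : Fin k → Finset (Fin n))
    (h3 : ∀ j, (P j).card = 3) (hs : ∀ j, ∑ i ∈ P j, r i = N) (J : Finset (Fin k)) :
    ∀ (R : Multiset ℕ) (w : List ℕ), St (∑ j ∈ J, (P j).val.map r + R) w →
    ∃ w', ReachIn (4 * J.card) w w' ∧ St (Multiset.replicate J.card N + R) w' := by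
  induction J using Finset.induction_on with
  | empty => intro R w h; exact ⟨w, rfl, by simpa using h⟩
  | insert j J hj ih =>
    intro R w h
    rw [Finset.sum_insert hj] at h
    obtain ⟨a, b, c, habc⟩ := Multiset.card_eq_three.mp
      (show ((P j).val.map r).card = 3 by simpa using h3 j)
    have hsum : a + b + c = N := by
      have : ((P j).val.map r).sum = N := hs j
      rw [habc] at this
      simpa [add_assoc] using this
    rw [habc] at h
    have e : ({a, b, c} : Multiset ℕ) + ∑ j ∈ J, (P j).val.map r + R =
        a ::ₘ b ::ₘ (c ::ₘ (∑ j ∈ J, (P j).val.map r + R)) := by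
      simp [Multiset.insert_eq_cons, add_assoc]
    rw [e] at h
    obtain ⟨w1, r1, s1⟩ := merge _ _ _ _ h
    obtain ⟨w2, r2, s2⟩ := merge _ _ _ _ s1
    rw [hsum, ← Multiset.add_cons] at s2
    obtain ⟨w3, r3, s3⟩ := ih _ _ s2
    refine ⟨w3, ?_, ?_⟩
    · rw [Finset.card_insert_of_notMem hj, show 4 * (J.card + 1) = 2 + 2 + 4 * J.card by ring]
      exact reach_trans (reach_trans r1 r2) r3
    · rw [Finset.card_insert_of_notMem hj, Multiset.replicate_succ]
      simpa using s3

lemma phase_two (N n : ℕ) : ∀ (x : ℕ) (V : List ℕ) (L : List (ℕ × ℕ)), 1 ≤ x →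
    (∀ p ∈ L, 1 ≤ p.2) → L.map Prod.fst = List.replicate (n + 1) N →
    ∃ X, ReachIn (2 * (n + 1)) (List.replicate x 0 ++ (V ++ bl L))
      (List.replicate X 0 ++ (V ++ (List.replicate N 1 ++ rep (0 :: List.replicate N 1) n))) := by
  induction n with
  | zero =>
    intro x V L hx hL hm
    obtain ⟨⟨a, y⟩, rfl⟩ : ∃ p, L = [p] := by
      rw [← List.length_eq_one_iff]
      simpa using congrArg List.length hm
    have ha : a = N := by simpa using hm
    subst ha
    refine ⟨x + y, ?_⟩
    have f1 := flipStep_append (List.replicate x 0 ++ V ++ List.replicate a 1)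
      (List.replicate y 0) (by
        intro h
        have := congrArg List.length h
        simp at this
        omega)
    have f2 := flipStep_append (List.replicate a 1 ++ V.reverse ++ List.replicate (x + y) 0) [] (by
        intro h
        have := congrArg List.length h
        simp at this
        omega)
    have f12 : ReachIn 2 (List.replicate x 0 ++ V ++ List.replicate a 1 ++ List.replicate y 0)
        (List.replicate (x + y) 0 ++ (V ++ List.replicate a 1)) := by
      refine reach_two f1 ?_
      convert f2 using 1
      · simp [List.replicate_add, -List.replicate_append_replicate]
      · simp
    convert f12 using 1
    · simp [bl]
    · simp [rep]
  | succ n ih =>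
    intro x V L hx hL hm
    obtain ⟨⟨a, y⟩, L, rfl⟩ : ∃ p K, L = p :: K := by
      cases L with
      | nil => simp [List.replicate_succ] at hm
      | cons p K => exact ⟨p, K, rfl⟩
    rw [List.replicate_succ, List.map_cons] at hm
    injection hm with ha hm
    simp only at ha
    subst ha
    have hy : 1 ≤ y := hL _ List.mem_cons_self
    obtain ⟨y, rfl⟩ : ∃ b, y = b + 1 := ⟨y - 1, by omega⟩
    obtain ⟨X, hX⟩ := ih (x + y) (V ++ (List.replicate a 1 ++ [0])) L (by omega)
      (fun p hp => hL p (List.mem_cons_of_mem _ hp)) hm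
    refine ⟨X, ?_⟩
    have f1 := flipStep_append (List.replicate x 0 ++ V ++ List.replicate a 1 ++ [0])
      (List.replicate y 0 ++ bl L) (by simp)
    have f2 := flipStep_append
      ([0] ++ List.replicate a 1 ++ V.reverse ++ List.replicate (x + y) 0) (bl L) (by simp)
    have f12 : ReachIn 2 (List.replicate x 0 ++ (V ++ bl ((a, y + 1) :: L)))
        (List.replicate (x + y) 0 ++ (V ++ (List.replicate a 1 ++ [0]) ++ bl L)) := by
      refine reach_two (t := [0] ++ List.replicate a 1 ++ V.reverse ++
        List.replicate (x + y) 0 ++ bl L) ?_ ?_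
      · convert f1 using 1
        · simp [bl_cons, List.replicate_succ]
        · simp [List.replicate_add, -List.replicate_append_replicate]
      · convert f2 using 1
        simp
    have := reach_trans f12 hX
    rw [show 2 * (n + 1 + 1) = 2 + 2 * (n + 1) by ring]
    convert this using 1
    simp [rep_succ]

lemma src_st (l : List ℕ) : St (l : Multiset ℕ) (src l) := by
  refine ⟨3, l.map (fun a => (a, 3)), by omega, ?_, by simp [Function.comp_def], ?_⟩
  · intro p hp
    obtain ⟨a, _, rfl⟩ := List.mem_map.mp hp
    simp
  · induction l with
    | nil => rfl
    | cons a l ih =>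
      rw [src_cons, ih, List.map_cons, bl_cons]
      rfl

lemma count_rep (N k : ℕ) : (rep (0 :: List.replicate N 1) k).count 0 = k ∧
    (rep (0 :: List.replicate N 1) k).count 1 = k * N := by
  induction k with
  | zero => simp [rep]
  | succ k ih =>
    rw [rep_succ]
    simp [ih.1, ih.2, List.count_replicate]
    ring

lemma count_src (l : List ℕ) : (src l).count 0 = 3 * l.length + 3 ∧ (src l).count 1 = l.sum ∧
    ∀ a, a ≠ 0 → a ≠ 1 → (src l).count a = 0 := by
  induction l with
  | nil => refine ⟨rfl, rfl, fun a h0 h1 => ?_⟩; simp [src, List.count_cons, Ne.symm h0]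
  | cons a l ih =>
    obtain ⟨h1, h2, h3⟩ := ih
    rw [src_cons]
    refine ⟨?_, ?_, fun b hb0 hb1 => ?_⟩
    · simp [h1, List.count_replicate]; ring
    · simp [h2, List.count_replicate]
    · simp [List.count_replicate, h3 b hb0 hb1, hb0, hb1, List.count_cons, Ne.symm hb0, Ne.symm hb1]

lemma perm_src_tgt (k N m : ℕ) (l : List ℕ) (hl : l.length = 3 * k) (hs : l.sum = k * N)
    (hm : m = 3 * (3 * k + 1) - k) :
    (src l).Perm (List.replicate m 0 ++ rep (0 :: List.replicate N 1) k) := by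
  obtain ⟨h1, h2, h3⟩ := count_src l
  obtain ⟨c1, c2⟩ := count_rep N k
  rw [List.perm_iff_count]
  intro a
  rw [List.count_append]
  by_cases ha0 : a = 0
  · subst ha0; rw [h1, c1]; simp; omega
  by_cases ha1 : a = 1
  · subst ha1; rw [h2, c2]; simp [List.count_replicate, hs]
  rw [h3 a ha0 ha1, eq_comm, Nat.add_eq_zero_iff]
  constructor
  · simp [List.count_replicate, Ne.symm ha0]
  · rw [List.count_eq_zero]
    intro hmem
    simp [rep] at hmem
    omega

theorem three_partition_reduction (k N : ℕ) (hk : 1 ≤ k) (hN : 0 < N)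
    (r : Fin (3*k) → ℕ) (hrpos : ∀ i, 0 < r i)
    (hlb : ∀ i, N < 4 * r i) (hub : ∀ i, 2 * r i < N)
    (hsum : ∑ i, r i = k * N) :
    ((∃ P : Fin k → Finset (Fin (3*k)),
        (∀ j, (P j).card = 3) ∧
        (∀ j, ∑ i ∈ P j, r i = N) ∧
        (∀ j₁ j₂, j₁ ≠ j₂ → Disjoint (P j₁) (P j₂)) ∧
        (∀ i, ∃ j, i ∈ P j)) ↔
      flipDist
        (((List.ofFn (fun i : Fin (3*k) => [0,0,0] ++ List.replicate (r i) 1)).flatten)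
          ++ [0,0,0])
        (List.replicate (3*(3*k+1) - k) 0 ++ rep (0 :: List.replicate N 1) k)
      ≤ 6*k) := by
  classical
  have hsrc : (((List.ofFn (fun i : Fin (3*k) => [0,0,0] ++ List.replicate (r i) 1)).flatten)
          ++ [0,0,0]) = src (List.ofFn r) := by
    rw [src, List.map_ofFn]
    rfl
  rw [hsrc]
  have hlsum : (List.ofFn r).sum = k * N := by rw [List.sum_ofFn, hsum]
  have hperm := perm_src_tgt k N _ (List.ofFn r) (by simp) hlsum rfl
  have hcoe : ((List.ofFn r : List ℕ) : Multiset ℕ) = Finset.univ.val.map r := by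
    rw [Fin.univ_val_map]
  constructor
  · rintro ⟨P, h3, hs, hd, hc⟩
    apply Nat.sInf_le
    have huniv : (Finset.univ : Finset (Fin (3*k))).val = ∑ j, (P j).val := by
      ext i
      rw [Multiset.count_sum', Multiset.count_eq_one_of_mem Finset.univ.nodup (Finset.mem_univ i)]
      obtain ⟨j, hj⟩ := hc i
      rw [Finset.sum_eq_single j]
      · exact (Multiset.count_eq_one_of_mem (P j).nodup hj).symm
      · intro j' _ hne
        rw [Multiset.count_eq_zero]
        intro hmem
        exact Finset.disjoint_left.mp (hd j' j hne) hmem hj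
      · simp
    have hst := src_st (List.ofFn r)
    have hmap : Finset.univ.val.map r = ∑ j, (P j).val.map r + 0 := by
      rw [huniv, add_zero]
      exact map_sum (Multiset.mapAddMonoidHom r) _ _
    rw [hcoe, hmap] at hst
    obtain ⟨w, hw, x, L, hx, hL, hLN, rfl⟩ := phase_one r P h3 hs Finset.univ 0 _ hst
    obtain ⟨n, rfl⟩ : ∃ n, k = n + 1 := ⟨k - 1, by omega⟩
    have hLN' : L.map Prod.fst = List.replicate (n + 1) N := by
      rw [add_zero, Finset.card_univ, Fintype.card_fin, ← Multiset.coe_replicate,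
        Multiset.coe_eq_coe] at hLN
      exact List.perm_replicate.mp hLN
    obtain ⟨X, hX⟩ := phase_two N n x [] L hx hL hLN'
    have hr := reach_trans hw hX
    rw [Finset.card_univ, Fintype.card_fin,
      show 4 * (n + 1) + 2 * (n + 1) = 6 * (n + 1) by ring] at hr
    have hp2 := ((reach_perm hr).symm.trans hperm).count_eq 0
    rw [List.nil_append, List.count_append, List.count_append, List.count_append,
      (count_rep N n).1, (count_rep N (n + 1)).1] at hp2
    simp [List.count_replicate] at hp2
    have hXe : X = 3 * (3 * (n + 1) + 1) - (n + 1) + 1 := by omega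
    show ReachIn _ _ _
    convert hr using 1
    rw [hXe, rep_succ, List.replicate_succ']
    simp
  · intro hle
    obtain ⟨m0, hm0⟩ := perm_reach hperm []
    have hne : {m | ReachIn m (src (List.ofFn r))
        (List.replicate (3*(3*k+1) - k) 0 ++ rep (0 :: List.replicate N 1) k)}.Nonempty :=
      ⟨m0, hm0⟩
    have hreach := Nat.sInf_mem hne
    change ReachIn (flipDist _ _) _ _ at hreach
    obtain ⟨a1, a2⟩ := reach_main r hreach
    obtain ⟨L, hL1, hL2⟩ := ch_src (List.ofFn r) (by
      intro a ha
      obtain ⟨i, rfl⟩ := (List.mem_ofFn' _ _).mp ha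
      exact hrpos i)
    have hpots : pot (src (List.ofFn r)) = 6 * k + 1 := by
      rw [pot, hL1, potL, hL2]
      simp [be]
      omega
    rw [pot_tgt N k _ hN (by omega), hpots] at a1 a2
    apply extract k N hN r hrpos hlb hub _ (a2 (by omega) _)
    obtain ⟨m, hm, _⟩ := chz_src (List.ofFn r)
    refine ⟨Finset.univ.val.map (fun i => {i}) + Multiset.replicate m 0, ?_, ?_⟩
    · rw [Multiset.sum_add, Multiset.sum_map_singleton]
      simp
    · rw [hm, hcoe, Multiset.map_add, Multiset.map_map, Multiset.map_replicate]
      congr 1
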